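/- Let 1 ≤ p ≤ q ≤ ∞ and ν ∈ ℕ. For k ≥ ν, the entropy numbers of the identity operator id : l_p^ν → l_q^ν satisfy e_k(id) ≤ C(p,q) · 2^{−k/ν} · ν^{1/q − 1/p} for a constant C(p,q). -/

import Mathlib

open Set Metric

/-- The `k`-th entropy number of a continuous linear operator `T : X → Y`. -/
noncomputable def entropyNumber {X Y : Type*} [NormedAddCommGroup X] [NormedSpace ℝ X]
    [NormedAddCommGroup Y] [NormedSpace ℝ Y] (T : X →L[ℝ] Y) (k : ℕ) : ℝ :=
  sInf {ε : ℝ | 0 < ε ∧ ∃ y : Fin (2 ^ (k - 1)) → Y,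
    (⇑T) '' Metric.closedBall 0 1 ⊆ ⋃ i, Metric.closedBall (y i) ε}

/-- The identity map `l_p^ν → l_q^ν` as a continuous linear map. -/
noncomputable def lpId (p q : ENNReal) [Fact (1 ≤ p)] [Fact (1 ≤ q)] (ν : ℕ) :
    PiLp p (fun _ : Fin ν => ℝ) →L[ℝ] PiLp q (fun _ : Fin ν => ℝ) :=
  LinearMap.toContinuousLinearMap
    (((WithLp.linearEquiv q ℝ (Fin ν → ℝ)).symm.toLinearMap).comp
      ((WithLp.linearEquiv p ℝ (Fin ν → ℝ)).toLinearMap))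

/-- A two-sided geometric sum is at most `1 + 2 / t`. -/
lemma sum_Icc_exp_neg_mul_abs_le {t : ℝ} (ht : 0 < t) (M : ℕ) :
    ∑ z ∈ Finset.Icc (-(M : ℤ)) M, Real.exp (-t * |(z : ℝ)|) ≤ 1 + 2 / t := by
  have heven : Function.Even fun z : ℤ => Real.exp (-t * |(z : ℝ)|) := fun z => by simp
  have hr : Real.exp (-t) < 1 := by simpa using ht
  have hgeom : ∑ n ∈ Finset.range (M + 1), Real.exp (-t * |((n : ℤ) : ℝ)|)
      ≤ (1 - Real.exp (-t))⁻¹ := by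
    have hterm (n : ℕ) : Real.exp (-t * |((n : ℤ) : ℝ)|) = Real.exp (-t) ^ n := by
      rw [← Real.exp_nat_mul]
      simp [mul_comm]
    simp_rw [hterm]
    rw [← tsum_geometric_of_lt_one (Real.exp_pos _).le hr]
    exact (summable_geometric_of_lt_one (Real.exp_pos _).le hr).sum_le_tsum _
      fun n _ => by positivity
  have hinv : (1 - Real.exp (-t))⁻¹ ≤ 1 + 1 / t := by
    have hexp : Real.exp (-t) * (t + 1) ≤ 1 := by
      calc Real.exp (-t) * (t + 1) ≤ Real.exp (-t) * Real.exp t := by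
            gcongr; exact Real.add_one_le_exp t
        _ = 1 := by rw [← Real.exp_add]; simp
    rw [inv_le_iff_one_le_mul₀ (by linarith), ← mul_le_mul_iff_left₀ ht]
    field_simp
    nlinarith
  rw [Finset.sum_Icc_of_even_eq_range heven]
  have : (2 : ℝ) / t = 2 * (1 / t) := by ring
  simp only [nsmul_eq_mul, Nat.cast_ofNat, Int.cast_zero, abs_zero, mul_zero, Real.exp_zero]
  linarith

/-- An exponential-moment bound for the number of integer points of an `ℓ¹`-ball. -/
lemma exists_finset_sum_abs_le {ι : Type*} [Fintype ι] [DecidableEq ι] (A : ℝ) {t : ℝ}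
    (ht : 0 < t) :
    ∃ S : Finset (ι → ℤ), (∀ z, z ∈ S ↔ ∑ i, |(z i : ℝ)| ≤ A) ∧
      (S.card : ℝ) ≤ Real.exp (t * A) * (1 + 2 / t) ^ Fintype.card ι := by
  set B : Finset (ι → ℤ) := Fintype.piFinset fun _ => Finset.Icc (-(⌊A⌋₊ : ℤ)) ⌊A⌋₊
  refine ⟨B.filter fun z => ∑ i, |(z i : ℝ)| ≤ A, fun z => ?_, ?_⟩
  · simp only [Finset.mem_filter, and_iff_right_iff_imp]
    intro hz
    refine Fintype.mem_piFinset.2 fun i => Finset.mem_Icc.2 (abs_le.1 ?_)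
    have hi : |(z i : ℝ)| ≤ A := (Finset.single_le_sum (f := fun i => |(z i : ℝ)|)
      (fun _ _ => abs_nonneg _) (Finset.mem_univ i)).trans hz
    rw [← Int.natCast_natAbs]
    exact_mod_cast Nat.le_floor (by simpa using hi)
  · have hprod : ∑ z ∈ B, ∏ i, Real.exp (-t * |(z i : ℝ)|) ≤ (1 + 2 / t) ^ Fintype.card ι := by
      rw [Finset.sum_prod_piFinset _ fun (_ : ι) (j : ℤ) => Real.exp (-t * |(j : ℝ)|),
        Finset.prod_const, Finset.card_univ]
      exact pow_le_pow_left₀ (by positivity) (sum_Icc_exp_neg_mul_abs_le ht _) _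
    calc ((B.filter fun z => ∑ i, |(z i : ℝ)| ≤ A).card : ℝ)
        = ∑ z ∈ B.filter fun z => ∑ i, |(z i : ℝ)| ≤ A, (1 : ℝ) := by simp
      _ ≤ ∑ z ∈ B.filter fun z => ∑ i, |(z i : ℝ)| ≤ A,
            Real.exp (t * A) * ∏ i, Real.exp (-t * |(z i : ℝ)|) := by
          refine Finset.sum_le_sum fun z hz => ?_
          rw [← Real.exp_sum, ← Real.exp_add, ← Finset.mul_sum]
          refine Real.one_le_exp ?_
          nlinarith [(Finset.mem_filter.1 hz).2]
      _ ≤ ∑ z ∈ B, Real.exp (t * A) * ∏ i, Real.exp (-t * |(z i : ℝ)|) :=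
          Finset.sum_le_sum_of_subset_of_nonneg (Finset.filter_subset _ _)
            fun _ _ _ => by positivity
      _ ≤ Real.exp (t * A) * (1 + 2 / t) ^ Fintype.card ι := by
          rw [← Finset.mul_sum]
          gcongr

/-- The `ℓ¹`-ball of radius `ν 2^((k-1)/ν) / 400` in `ℝ^ν` has at most `2^(k-1)` integer points. -/
lemma exists_finset_sum_abs_le_card_le_two_pow {ν k : ℕ} (hν : 1 ≤ ν) (hk : ν ≤ k) :
    ∃ S : Finset (Fin ν → ℤ), S.card ≤ 2 ^ (k - 1) ∧
      ∀ z : Fin ν → ℤ, ∑ i, |(z i : ℝ)| ≤ ν * (2 : ℝ) ^ (((k : ℝ) - 1) / ν) / 400 → z ∈ S := by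
  have hν0 : (0 : ℝ) < ν := by exact_mod_cast hν
  rcases (hν.trans hk).eq_or_lt with rfl | hk1
  · obtain rfl : ν = 1 := le_antisymm hk hν
    refine ⟨{0}, by simp, fun z hz => Finset.mem_singleton.2 (funext fun i => ?_)⟩
    rw [Subsingleton.elim i 0]
    norm_num at hz
    have hlt : |(z 0 : ℝ)| < 1 := by linarith
    exact Int.abs_lt_one_iff.1 (by exact_mod_cast hlt)
  set g : ℝ := (2 : ℝ) ^ (((k : ℝ) - 1) / ν) with hg
  have hg0 : 0 < g := by positivity
  have hgpow : g ^ ν = 2 ^ (k - 1) := by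
    rw [hg, ← Real.rpow_mul_natCast two_pos.le, div_mul_cancel₀ _ hν0.ne', ← Real.rpow_natCast,
      Nat.cast_sub hk1.le, Nat.cast_one]
  have hg2 : 2 ≤ g ^ 2 := by
    rw [hg, ← Real.rpow_mul_natCast two_pos.le]
    refine (Real.rpow_one 2).symm.le.trans (Real.rpow_le_rpow_of_exponent_le one_le_two ?_)
    rw [div_mul_eq_mul_div, one_le_div hν0]
    have h1 : (ν : ℝ) ≤ k := by exact_mod_cast hk
    have h2 : (2 : ℝ) ≤ k := by exact_mod_cast hk1
    push_cast
    linarith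
  have hg14 : 1.4 ≤ g := by nlinarith
  obtain ⟨S, hS, hcard⟩ := exists_finset_sum_abs_le (ι := Fin ν) (ν * g / 400)
    (show 0 < 8 / g by positivity)
  refine ⟨S, ?_, fun z => (hS z).2⟩
  have hexp : Real.exp (1 / 50) ≤ 50 / 49 := by
    have h := Real.add_one_le_exp (-(1 / 50) : ℝ)
    rw [Real.exp_neg] at h
    have := (le_inv_comm₀ (by norm_num) (Real.exp_pos _)).1 h
    norm_num at this ⊢
    exact this
  have hbase : Real.exp (1 / 50) * (1 + 2 / (8 / g)) ≤ g := by
    calc Real.exp (1 / 50) * (1 + 2 / (8 / g)) ≤ 50 / 49 * (1 + 2 / (8 / g)) := by gcongr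
      _ = 50 / 49 * (1 + g / 4) := by field_simp; ring
      _ ≤ g := by linarith
  have : (S.card : ℝ) ≤ 2 ^ (k - 1) := by
    calc (S.card : ℝ) ≤ Real.exp (8 / g * (ν * g / 400)) * (1 + 2 / (8 / g)) ^ ν := by
          simpa using hcard
      _ = (Real.exp (1 / 50) * (1 + 2 / (8 / g))) ^ ν := by
          rw [mul_pow, ← Real.exp_nat_mul]
          congr 2
          field_simp
          norm_num
      _ ≤ g ^ ν := by gcongr
      _ = 2 ^ (k - 1) := hgpow
  exact_mod_cast this

/-- Rounding to the nearest integer at most doubles the absolute value. -/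
lemma abs_round_le_two_mul_abs (x : ℝ) : |(round x : ℝ)| ≤ 2 * |x| := by
  rcases eq_or_ne (round x) 0 with h | h
  · simp [h]
  · have h1 : (1 : ℝ) ≤ |(round x : ℝ)| := by exact_mod_cast Int.one_le_abs h
    have h2 := abs_sub_round x
    have h3 := abs_sub_abs_le_abs_sub (round x : ℝ) x
    rw [abs_sub_comm] at h3
    linarith

/-- Comparison of the `ℓ¹`-norm with the `ℓ^p`-norm. -/
lemma PiLp.sum_abs_le_card_rpow_mul_norm {ι : Type*} [Fintype ι] [Nonempty ι] (p : ENNReal)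
    [Fact (1 ≤ p)] (x : PiLp p fun _ : ι => ℝ) :
    ∑ i, |x i| ≤ (Fintype.card ι : ℝ) ^ (1 - 1 / p.toReal) * ‖x‖ := by
  have hι : (0 : ℝ) < Fintype.card ι := by exact_mod_cast Fintype.card_pos
  rcases p.dichotomy with rfl | hp
  · simpa using Finset.sum_le_card_nsmul Finset.univ (fun i => |x i|) ‖x‖
      fun i _ => PiLp.norm_apply_le x i
  · have hp0 : 0 < p.toReal := zero_lt_one.trans_le hp
    have h := Real.rpow_sum_le_const_mul_sum_rpow Finset.univ (fun i => x i) hp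
    rw [← Real.rpow_le_rpow_iff (by positivity) (by positivity) hp0,
      Real.mul_rpow (by positivity) (norm_nonneg _), ← Real.rpow_mul hι.le,
      PiLp.norm_eq_sum hp0, ← Real.rpow_mul (by positivity), sub_mul, one_div,
      inv_mul_cancel₀ hp0.ne', one_mul, Real.rpow_one]
    simpa using h

lemma entropyNumber_le_of_finset {X Y ι : Type*} [NormedAddCommGroup X] [NormedSpace ℝ X]
    [NormedAddCommGroup Y] [NormedSpace ℝ Y] (T : X →L[ℝ] Y) {k : ℕ} {ε : ℝ} (hε : 0 < ε)
    (S : Finset ι) (hS : S.card ≤ 2 ^ (k - 1)) (c : ι → Y)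
    (h : ∀ x, ‖x‖ ≤ 1 → ∃ s ∈ S, dist (T x) (c s) ≤ ε) : entropyNumber T k ≤ ε := by
  refine csInf_le ⟨0, fun _ hδ => hδ.1.le⟩ ⟨hε, ?_⟩
  obtain ⟨f⟩ : Nonempty (S ↪ Fin (2 ^ (k - 1))) :=
    Function.Embedding.nonempty_of_card_le (by simpa using hS)
  refine ⟨Function.extend f (fun s => c s) 0, ?_⟩
  rintro _ ⟨x, hx, rfl⟩
  obtain ⟨s, hs, hd⟩ := h x (by simpa using hx)
  refine Set.mem_iUnion.2 ⟨f ⟨s, hs⟩, ?_⟩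
  rwa [f.injective.extend_apply, Metric.mem_closedBall]

/-- Large-`k` regime of Schütt's theorem: for `k ≥ ν`,
`e_k(id : l_p^ν → l_q^ν) ≤ C(p,q) · 2^{-k/ν} · ν^{1/q - 1/p}`. -/
theorem schuett_large_k (p q : ENNReal) [Fact (1 ≤ p)] [Fact (1 ≤ q)] (hpq : p ≤ q) :
    ∃ C : ℝ, 0 < C ∧ ∀ (ν : ℕ), 1 ≤ ν → ∀ k : ℕ, ν ≤ k →
      entropyNumber (lpId p q ν) k ≤
        C * (2:ℝ) ^ (-(k:ℝ) / (ν:ℝ)) * (ν:ℝ) ^ (1 / q.toReal - 1 / p.toReal) := by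
  refine ⟨800, by norm_num, fun ν hν k hk => ?_⟩
  have hν0 : (0 : ℝ) < ν := by exact_mod_cast hν
  have : Nonempty (Fin ν) := ⟨⟨0, hν⟩⟩
  obtain ⟨S, hcard, hS⟩ := exists_finset_sum_abs_le_card_le_two_pow hν hk
  set g : ℝ := (2 : ℝ) ^ (((k : ℝ) - 1) / ν) with hg
  have hg0 : 0 < g := by positivity
  set h : ℝ := 800 * (ν : ℝ) ^ (-(1 / p.toReal)) / g with hh
  have hh0 : 0 < h := by positivity
  have hginv : 1 / g ≤ 2 * (2 : ℝ) ^ (-(k : ℝ) / ν) := by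
    calc 1 / g = (2 : ℝ) ^ (1 / (ν : ℝ)) * (2 : ℝ) ^ (-(k : ℝ) / ν) := by
          rw [hg, one_div, ← Real.rpow_neg two_pos.le, ← Real.rpow_add two_pos]
          congr 1
          ring
      _ ≤ (2 : ℝ) ^ (1 : ℝ) * (2 : ℝ) ^ (-(k : ℝ) / ν) := by
          gcongr
          · exact one_le_two
          · rw [div_le_one hν0]
            exact_mod_cast hν
      _ = 2 * (2 : ℝ) ^ (-(k : ℝ) / ν) := by rw [Real.rpow_one]
  calc entropyNumber (lpId p q ν) k ≤ (ν : ℝ) ^ (1 / q.toReal) * (h / 2) := by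
        refine entropyNumber_le_of_finset _ (by positivity) S hcard
          (fun z => WithLp.toLp q fun i => h * (z i : ℝ)) fun x hx => ?_
        refine ⟨fun i => round (x i / h), hS _ ?_, ?_⟩
        · calc ∑ i, |(round (x i / h) : ℝ)| ≤ ∑ i, 2 / h * |x i| := by
                refine Finset.sum_le_sum fun i _ => (abs_round_le_two_mul_abs _).trans_eq ?_
                rw [abs_div, abs_of_pos hh0]
                ring
            _ ≤ 2 / h * ((ν : ℝ) ^ (1 - 1 / p.toReal) * 1) := by
                rw [← Finset.mul_sum]
                gcongr
                refine (PiLp.sum_abs_le_card_rpow_mul_norm p x).trans ?_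
                rw [Fintype.card_fin]
                gcongr
            _ = ν * g / 400 := by
                rw [sub_eq_add_neg, Real.rpow_add hν0, Real.rpow_one, hh]
                field_simp
                norm_num
        · have hdist := (PiLp.lipschitzWith_toLp q fun _ : Fin ν => ℝ).dist_le_mul
            (WithLp.ofLp x) fun i => h * (round (x i / h) : ℝ)
          refine hdist.trans ?_
          simp only [Fintype.card_fin, NNReal.coe_rpow, NNReal.coe_natCast, ENNReal.toReal_div,
            ENNReal.toReal_one]
          gcongr
          refine (dist_pi_le_iff (by positivity)).2 fun i => ?_
          have hi := abs_sub_round (x i / h)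
          have heq : x i - h * (round (x i / h) : ℝ) = h * (x i / h - round (x i / h)) := by
            field_simp
          rw [Real.dist_eq, heq, abs_mul, abs_of_pos hh0]
          nlinarith
    _ = 400 * (1 / g) * (ν : ℝ) ^ (1 / q.toReal - 1 / p.toReal) := by
        rw [sub_eq_add_neg, Real.rpow_add hν0, hh]
        ring
    _ ≤ 400 * (2 * (2 : ℝ) ^ (-(k : ℝ) / ν)) * (ν : ℝ) ^ (1 / q.toReal - 1 / p.toReal) := by
        gcongr
    _ = 800 * (2 : ℝ) ^ (-(k : ℝ) / ν) * (ν : ℝ) ^ (1 / q.toReal - 1 / p.toReal) := by ring
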